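/- The pushforward of the product measure μ_a ⊗ μ_a under the map (φ₁, φ₂) ↦ |e^{iφ₁} + e^{iφ₂}| is absolutely continuous with respect to Lebesgue measure on ℝ, with density f given by f(r) = 2·(a − arccos(r/2)) / (a² · √(4 − r²)) for 2·cos a < r < 2, and f(r) = 0 otherwise. -/

import Mathlib

open MeasureTheory Real

/-- The uniform probability measure on the interval `[-a, a]`:
Lebesgue measure restricted to `[-a, a]`, normalized by `1/(2a)`. -/
noncomputable def mu (a : ℝ) : Measure ℝ :=
  (ENNReal.ofReal (2 * a))⁻¹ • volume.restrict (Set.Icc (-a) a)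

/-- The density of the radius after two steps. -/
noncomputable def radiusDensity (a : ℝ) (r : ℝ) : ℝ :=
  if 2 * Real.cos a < r ∧ r < 2 then
    2 * (a - Real.arccos (r / 2)) / (a ^ 2 * Real.sqrt (4 - r ^ 2))
  else 0

lemma norm_exp_mul_I_add_exp_mul_I (x y : ℝ) :
    ‖Complex.exp ((x : ℂ) * Complex.I) + Complex.exp ((y : ℂ) * Complex.I)‖
      = 2 * |cos ((x - y) / 2)| := by
  have h : Complex.exp ((x : ℂ) * Complex.I) + Complex.exp ((y : ℂ) * Complex.I)
      = Complex.exp (((x + y) / 2 : ℝ) * Complex.I) * ((2 * cos ((x - y) / 2) : ℝ) : ℂ) := by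
    push_cast
    rw [Complex.cos, mul_div_cancel₀ _ two_ne_zero, mul_add, ← Complex.exp_add, ← Complex.exp_add]
    ring_nf
  rw [h, norm_mul, Complex.norm_exp_ofReal_mul_I, one_mul, Complex.norm_real, norm_mul]
  simp

lemma lintegral_comp_abs_eq (F : ℝ → ENNReal) :
    ∫⁻ x, F |x| = 2 * ∫⁻ x in Set.Ioi 0, F x := by
  have hpos : ∫⁻ x in Set.Ioi (0 : ℝ), F |x| = ∫⁻ x in Set.Ioi 0, F x :=
    setLIntegral_congr_fun measurableSet_Ioi fun x hx => by rw [abs_of_pos hx]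
  have hneg : ∫⁻ x in Set.Iic (0 : ℝ), F |x| = ∫⁻ x in Set.Ioi 0, F |x| := by
    rw [setLIntegral_congr (Iio_ae_eq_Iic (a := (0 : ℝ))).symm,
      ← (Measure.measurePreserving_neg (volume : Measure ℝ)).setLIntegral_comp_preimage_emb
        (MeasurableEquiv.neg ℝ).measurableEmbedding]
    simp
  rw [← lintegral_add_compl _ (measurableSet_Ioi (a := (0 : ℝ))), Set.compl_Ioi, hneg, hpos, two_mul]

lemma volume_Icc_inter_preimage_add (a d : ℝ) :
    volume {y : ℝ | y ∈ Set.Icc (-a) a ∧ d + y ∈ Set.Icc (-a) a} = ENNReal.ofReal (2 * a - |d|) := by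
  have : {y : ℝ | y ∈ Set.Icc (-a) a ∧ d + y ∈ Set.Icc (-a) a}
      = Set.Icc (max (-a) (-a - d)) (min a (a - d)) := by
    ext y
    simp only [Set.mem_ofPred_eq, Set.mem_Icc, max_le_iff, le_min_iff]
    grind
  rw [this, Real.volume_Icc]
  congr 1
  grind

lemma setLIntegral_setLIntegral_sub (a : ℝ) {F : ℝ → ENNReal} (hF : Measurable F) :
    ∫⁻ x in Set.Icc (-a) a, ∫⁻ y in Set.Icc (-a) a, F (x - y)
      = ∫⁻ d, F d * ENNReal.ofReal (2 * a - |d|) := by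
  set I := Set.Icc (-a) a
  have hI : MeasurableSet I := measurableSet_Icc
  rw [lintegral_lintegral_swap (by fun_prop), ← lintegral_indicator hI]
  have h1 (y : ℝ) : I.indicator (fun y => ∫⁻ x in I, F (x - y)) y
      = ∫⁻ d, {p : ℝ × ℝ | p.1 ∈ I ∧ p.2 + p.1 ∈ I}.indicator (fun p => F p.2) (y, d) := by
    rw [← lintegral_sub_right_eq_self _ y]
    by_cases hy : y ∈ I
    · rw [Set.indicator_of_mem hy, ← lintegral_indicator hI]
      refine lintegral_congr fun x => ?_
      simp [Set.indicator, hy]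
    · simp [Set.indicator, hy]
  have hm : MeasurableSet {p : ℝ × ℝ | p.1 ∈ I ∧ p.2 + p.1 ∈ I} :=
    (measurable_fst hI).inter ((measurable_snd.add measurable_fst) hI)
  rw [lintegral_congr h1, lintegral_lintegral_swap
    (f := fun y d => {p : ℝ × ℝ | p.1 ∈ I ∧ p.2 + p.1 ∈ I}.indicator (fun p => F p.2) (y, d))
    ((hF.comp measurable_snd).indicator hm).aemeasurable]
  refine lintegral_congr fun d => ?_
  rw [← volume_Icc_inter_preimage_add]
  exact lintegral_indicator_const (measurable_prodMk_right hm) (F d)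

lemma image_two_mul_arccos_half {a : ℝ} (ha : 0 < a) (ha' : a ≤ π) :
    (fun r => 2 * arccos (r / 2)) '' Set.Ioo (2 * cos a) 2 = Set.Ioo 0 (2 * a) := by
  ext d
  constructor
  · rintro ⟨r, ⟨h1, h2⟩, rfl⟩
    have : arccos (r / 2) < a := by
      rw [← arccos_cos ha.le ha']
      exact (strictAntiOn_arccos.lt_iff_gt ⟨by linarith [neg_one_le_cos a], by linarith⟩
        ⟨neg_one_le_cos a, cos_le_one a⟩).2 (by linarith)
    have : 0 < arccos (r / 2) := arccos_pos.2 (by linarith)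
    constructor <;> dsimp only <;> linarith
  · rintro ⟨h1, h2⟩
    refine ⟨2 * cos (d / 2), ⟨?_, ?_⟩, ?_⟩
    · have := cos_lt_cos_of_nonneg_of_le_pi (x := d / 2) (y := a) (by linarith) ha' (by linarith)
      linarith
    · have := cos_lt_cos_of_nonneg_of_le_pi (x := 0) (y := d / 2) le_rfl (by linarith) (by linarith)
      rw [cos_zero] at this
      linarith
    · dsimp only
      rw [mul_div_cancel_left₀ _ two_ne_zero, arccos_cos (by linarith) (by linarith)]
      ring

lemma hasDerivAt_two_mul_arccos_half {r : ℝ} (h1 : -2 < r) (h2 : r < 2) :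
    HasDerivAt (fun r => 2 * arccos (r / 2)) (-(2 / √(4 - r ^ 2))) r := by
  have h := ((hasDerivAt_arccos (x := r / 2) (by linarith) (by linarith)).comp r
    ((hasDerivAt_id r).div_const 2)).const_mul 2
  refine h.congr_deriv ?_
  have : (4 - r ^ 2) = 2 ^ 2 * (1 - (r / 2) ^ 2) := by ring
  rw [this, sqrt_mul (by norm_num), sqrt_sq (by norm_num)]
  ring

lemma setLIntegral_Ioo_eq_arccos {a : ℝ} (ha : 0 < a) (ha' : a ≤ π) (G : ℝ → ENNReal) :
    ∫⁻ d in Set.Ioo 0 (2 * a), G d = ∫⁻ r in Set.Ioo (2 * cos a) 2,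
      ENNReal.ofReal (2 / √(4 - r ^ 2)) * G (2 * arccos (r / 2)) := by
  have hlo := neg_one_le_cos a
  rw [← image_two_mul_arccos_half ha ha', lintegral_image_eq_lintegral_abs_deriv_mul
    (f' := fun r => -(2 / √(4 - r ^ 2))) measurableSet_Ioo
    (fun r hr => (hasDerivAt_two_mul_arccos_half (by linarith [hr.1]) hr.2).hasDerivWithinAt)]
  · refine setLIntegral_congr_fun measurableSet_Ioo fun r _ => ?_
    rw [abs_neg, abs_of_nonneg (by positivity)]
  · intro r hr s hs h
    have := strictAntiOn_arccos.injOn (x₁ := r / 2) (x₂ := s / 2)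
      ⟨by linarith [hr.1], by linarith [hr.2]⟩ ⟨by linarith [hs.1], by linarith [hs.2]⟩
      (mul_left_cancel₀ two_ne_zero h)
    linarith

lemma measurable_radiusDensity (a : ℝ) : Measurable (radiusDensity a) :=
  Measurable.ite (measurableSet_Ioo (a := 2 * cos a) (b := 2))
    (by have := measurable_arccos; fun_prop) measurable_const

lemma lintegral_mu_prod_mu_sub (a : ℝ) {F : ℝ → ENNReal} (hF : Measurable F) :
    ∫⁻ p : ℝ × ℝ, F (p.1 - p.2) ∂((mu a).prod (mu a)) =
      (ENNReal.ofReal (2 * a))⁻¹ * ((ENNReal.ofReal (2 * a))⁻¹ *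
        ∫⁻ d, F d * ENNReal.ofReal (2 * a - |d|)) := by
  have : SFinite (mu a) := by unfold mu; infer_instance
  rw [lintegral_prod _ (by fun_prop)]
  simp only [mu, lintegral_smul_measure, smul_eq_mul]
  rw [lintegral_const_mul _ (by fun_prop), setLIntegral_setLIntegral_sub a hF]

lemma lintegral_mul_radiusDensity {a : ℝ} (ha : 0 < a) (ha' : a ≤ π / 2) (g : ℝ → ENNReal) :
    ∫⁻ d, g (2 * |cos (d / 2)|) * ENNReal.ofReal (2 * a - |d|) =
      ENNReal.ofReal (2 * a) * (ENNReal.ofReal (2 * a) *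
        ∫⁻ r, ENNReal.ofReal (radiusDensity a r) * g r) := by
  have hzero : ∫⁻ t in Set.Ici (2 * a), g (2 * |cos (t / 2)|) * ENNReal.ofReal (2 * a - t) = 0 :=
    setLIntegral_eq_zero measurableSet_Ici fun t ht => by
      simp [ENNReal.ofReal_of_nonpos (sub_nonpos.2 (Set.mem_Ici.1 ht))]
  have habs (d : ℝ) : g (2 * |cos (d / 2)|) * ENNReal.ofReal (2 * a - |d|) =
      (fun t => g (2 * |cos (t / 2)|) * ENNReal.ofReal (2 * a - t)) |d| := by
    have : |d| / 2 = |d / 2| := by rw [abs_div, abs_two]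
    simp only [this, cos_abs]
  rw [lintegral_congr habs,
    lintegral_comp_abs_eq (fun t => g (2 * |cos (t / 2)|) * ENNReal.ofReal (2 * a - t)),
    ← Set.Ioo_union_Ici_eq_Ioi (by linarith : 0 < 2 * a),
    lintegral_union measurableSet_Ici
      (Set.disjoint_left.2 fun t ht ht' => (Set.mem_Ici.1 ht').not_gt ht.2), hzero, add_zero,
    setLIntegral_Ioo_eq_arccos ha (by linarith [pi_pos]), ← lintegral_const_mul' _ _ (by finiteness),
    ← lintegral_const_mul' _ _ (by finiteness), ← lintegral_const_mul' _ _ (by finiteness),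
    ← lintegral_indicator measurableSet_Ioo]
  refine lintegral_congr fun r => ?_
  by_cases hr : r ∈ Set.Ioo (2 * cos a) 2
  · have hr' : 2 * cos a < r ∧ r < 2 := hr
    have hc : 0 ≤ cos a := cos_nonneg_of_neg_pi_div_two_le_of_le (by linarith) ha'
    have hs : 0 < √(4 - r ^ 2) := sqrt_pos.2 (by nlinarith)
    have hcos : 2 * |cos (2 * arccos (r / 2) / 2)| = r := by
      rw [mul_div_cancel_left₀ _ two_ne_zero, cos_arccos (by linarith) (by linarith),
        abs_of_nonneg (by linarith)]
      ring
    rw [Set.indicator_of_mem hr, radiusDensity, if_pos hr', hcos, ← mul_assoc (ENNReal.ofReal _) _ (g r),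
      ← mul_assoc (ENNReal.ofReal _) _ (g r), ← ENNReal.ofReal_mul (by positivity),
      ← ENNReal.ofReal_mul (by positivity), mul_comm (g r), ← mul_assoc, ← mul_assoc,
      ← ENNReal.ofReal_ofNat 2, ← ENNReal.ofReal_mul (by positivity),
      ← ENNReal.ofReal_mul (by positivity)]
    congr 2
    field_simp
  · have hr' : ¬ (2 * cos a < r ∧ r < 2) := hr
    simp [radiusDensity, hr']

theorem stmt1 (a : ℝ) (ha : 0 < a) (ha' : a ≤ π / 2) :
    (Measure.map
        (fun p : ℝ × ℝ =>
          ‖Complex.exp ((p.1 : ℂ) * Complex.I) + Complex.exp ((p.2 : ℂ) * Complex.I)‖)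
        ((mu a).prod (mu a))) ≪ volume ∧
    (Measure.map
        (fun p : ℝ × ℝ =>
          ‖Complex.exp ((p.1 : ℂ) * Complex.I) + Complex.exp ((p.2 : ℂ) * Complex.I)‖)
        ((mu a).prod (mu a)))
      = volume.withDensity (fun r => ENNReal.ofReal (radiusDensity a r)) := by
  refine and_iff_right_of_imp (fun h => h ▸ withDensity_absolutelyContinuous _ _) |>.2 ?_
  simp_rw [norm_exp_mul_I_add_exp_mul_I]
  have h0 : ENNReal.ofReal (2 * a) ≠ 0 := by simpa using ha
  have htop : ENNReal.ofReal (2 * a) ≠ ⊤ := ENNReal.ofReal_ne_top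
  refine Measure.ext_of_lintegral _ fun g hg => ?_
  rw [lintegral_map hg (by fun_prop), lintegral_withDensity_eq_lintegral_mul _
    (measurable_radiusDensity a).ennreal_ofReal hg,
    lintegral_mu_prod_mu_sub a (F := fun d => g (2 * |cos (d / 2)|)) (by fun_prop),
    lintegral_mul_radiusDensity ha ha', ENNReal.inv_mul_cancel_left h0 htop,
    ENNReal.inv_mul_cancel_left h0 htop]
  rfl
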